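/- arXiv:1905.02883 — 3 statements merged into one kernel-verified Lean document; each statement's English description precedes it below -/
import Mathlib

section
/- Let (Ω,μ) = ∏_{i=1}^n (Ω_i,μ_i) be a finite product probability space in which each factor Ω_i is linearly ordered. Let A_1,…,A_k ⊆ Ω be arbitrary events, define X(ω) = max{|I| : I ⊆ [k] and A_i, i ∈ I, occur disjointly at ω}, and set λ = Σ_{i=1}^k μ(A_i). Then for every t ≥ 0, μ({ω : X(ω) ≥ λ + t}) ≤ exp(−λ φ(t/λ)), where φ(x) = (1+x)log(1+x) − x. -/
open MeasureTheory ProbabilityTheory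

/-- The events `A j`, `j ∈ I`, occur disjointly at `ω`: there are pairwise disjoint
sets `S j ⊆ [n]` such that every `ω'` agreeing with `ω` on `S j` lies in `A j`. -/
def OccurDisjointly {n : ℕ} {Ω : Fin n → Type*} {ι : Type*}
    (A : ι → Set (∀ i, Ω i)) (I : Finset ι) (ω : ∀ i, Ω i) : Prop :=
  ∃ S : ι → Finset (Fin n),
    (∀ j ∈ I, ∀ j' ∈ I, j ≠ j' → Disjoint (S j) (S j')) ∧
    ∀ j ∈ I, ∀ ω' : ∀ i, Ω i, (∀ i ∈ S j, ω' i = ω i) → ω' ∈ A j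

/-- `X ω` is the maximum size of a set `I ⊆ [k]` such that the events
`A j`, `j ∈ I`, occur disjointly at `ω`. -/
noncomputable def maxDisjOcc {n k : ℕ} {Ω : Fin n → Type*}
    (A : Fin k → Set (∀ i, Ω i)) (ω : ∀ i, Ω i) : ℕ :=
  sSup {m : ℕ | ∃ I : Finset (Fin k), I.card = m ∧ OccurDisjointly A I ω}

/-- The Chernoff rate function `φ(x) = (1+x) log (1+x) − x`. -/
noncomputable def chernoffPhi (x : ℝ) : ℝ := (1 + x) * Real.log (1 + x) - x


namespace ReimerAux

open Finset

/-- The two orthogonal bases of the plane used in the linear algebra argument. -/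
def wv : Bool → Bool → Bool → ℤ
  | false, true, false => 1
  | false, true, true => 0
  | false, false, false => 0
  | false, false, true => 1
  | true, true, false => 1
  | true, true, true => 1
  | true, false, false => 1
  | true, false, true => -1

/-- First basis. -/
def fv : Bool → Bool → ℚ
  | false, false => 1
  | false, true => -1
  | true, false => 0
  | true, true => 1

/-- Dual basis. -/
def gv : Bool → Bool → ℚ
  | false, false => 1
  | false, true => 0
  | true, false => 1
  | true, true => 1

lemma mod_two_indep : ∀ (n : ℕ) (s : (Fin n → Bool) → (Fin n → Bool))
    (α : (Fin n → Bool) → ZMod 2),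
    (∀ z : Fin n → Bool, ∑ x, α x * ∏ i, ((wv (x i) (s x i) (z i) : ℤ) : ZMod 2) = 0) →
    ∀ x, α x = 0 := by
  intro n
  induction n with
  | zero =>
    intro s α h x
    have := h x
    rw [Fintype.sum_eq_single x (fun y hy => absurd (Subsingleton.elim y x) hy)] at this
    simpa using this
  | succ n ih =>
    intro s α h
    have key : ∀ (a : Bool) (z : Fin n → Bool),
        (∑ x : Fin n → Bool, α (Fin.cons false x) *
          (((wv false (s (Fin.cons false x) 0) a : ℤ) : ZMod 2) *
            ∏ i, ((wv (x i) (s (Fin.cons false x) i.succ) (z i) : ℤ) : ZMod 2)))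
        + (∑ x : Fin n → Bool, α (Fin.cons true x) *
            ∏ i, ((wv (x i) (s (Fin.cons true x) i.succ) (z i) : ℤ) : ZMod 2)) = 0 := by
      intro a z
      have h1 := h (Fin.cons a z)
      rw [← (Fin.consEquiv (fun _ => Bool)).sum_comp, Fintype.sum_prod_type,
        Fintype.sum_bool, add_comm] at h1
      have hc : ∀ (b : Bool) (x : Fin n → Bool),
          (Fin.consEquiv (fun _ => Bool)) (b, x) = (Fin.cons b x : Fin (n + 1) → Bool) :=
        fun _ _ => rfl
      simp only [hc, Fin.prod_univ_succ, Fin.cons_zero, Fin.cons_succ] at h1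
      rw [← h1]
      congr 1
      refine Finset.sum_congr rfl fun x _ => ?_
      have : ((wv true (s (Fin.cons true x) 0) a : ℤ) : ZMod 2) = 1 := by
        generalize s (Fin.cons true x) 0 = b
        clear h1
        revert a b; decide
      rw [this, one_mul]
    have h0 : ∀ x, α (Fin.cons false x) = 0 := by
      apply ih (fun x i => s (Fin.cons false x) i.succ) (fun x => α (Fin.cons false x))
      intro z
      have e1 := key false z
      have e2 := key true z
      have e3 := congrArg₂ (· + ·) e1 e2
      simp only [add_zero] at e3
      rw [add_add_add_comm, CharTwo.add_self_eq_zero, add_zero, ← Finset.sum_add_distrib] at e3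
      rw [← e3]
      refine Finset.sum_congr rfl fun x _ => ?_
      rw [← mul_add, ← add_mul]
      have : ((wv false (s (Fin.cons false x) 0) false : ℤ) : ZMod 2)
          + ((wv false (s (Fin.cons false x) 0) true : ℤ) : ZMod 2) = 1 := by
        generalize s (Fin.cons false x) 0 = b
        revert b; decide
      rw [this, one_mul]
    have h1 : ∀ x, α (Fin.cons true x) = 0 := by
      apply ih (fun x i => s (Fin.cons true x) i.succ) (fun x => α (Fin.cons true x))
      intro z
      have e1 := key false z
      simpa [h0] using e1
    intro x
    rw [← Fin.cons_self_tail x]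
    cases x 0
    · exact h0 _
    · exact h1 _

lemma rat_indep (n : ℕ) (s : (Fin n → Bool) → (Fin n → Bool))
    (α : (Fin n → Bool) → ℚ)
    (h : ∀ z : Fin n → Bool, ∑ x, α x * ∏ i, ((wv (x i) (s x i) (z i) : ℤ) : ℚ) = 0) :
    ∀ x, α x = 0 := by
  let W : Matrix (Fin n → Bool) (Fin n → Bool) ℤ := Matrix.of fun x z => ∏ i, wv (x i) (s x i) (z i)
  have d2 : ((Int.castRingHom (ZMod 2)).mapMatrix W).det ≠ 0 := by
    intro hd
    obtain ⟨v, hv, hv0⟩ := Matrix.exists_vecMul_eq_zero_iff.mpr hd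
    apply hv
    funext x
    refine mod_two_indep n s v (fun z => ?_) x
    have := congrFun hv0 z
    simpa [Matrix.vecMul, dotProduct, W, RingHom.mapMatrix_apply, Matrix.map_apply] using this
  have dZ : W.det ≠ 0 := by
    intro h0
    apply d2
    rw [← RingHom.map_det, h0, map_zero]
  have dQ : ((Int.castRingHom ℚ).mapMatrix W).det ≠ 0 := by
    rw [← RingHom.map_det]
    simpa using dZ
  by_contra hne
  push Not at hne
  obtain ⟨x, hx⟩ := hne
  apply dQ
  rw [← Matrix.exists_vecMul_eq_zero_iff]
  refine ⟨α, fun h0 => hx (congrFun h0 x), ?_⟩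
  funext z
  have := h z
  simpa [Matrix.vecMul, dotProduct, W] using this

lemma dual_bases {n : ℕ} (h : (Fin n → Bool) → ℚ) :
    ∑ y : Fin n → Bool, (∑ z, h z * ∏ i, fv (y i) (z i)) * (∑ z, h z * ∏ i, gv (y i) (z i))
      = ∑ z, h z ^ 2 := by
  have h1 : ∀ z z' : Fin n → Bool,
      ∑ y : Fin n → Bool, (∏ i, fv (y i) (z i)) * (∏ i, gv (y i) (z' i))
        = if z = z' then 1 else 0 := by
    intro z z'
    have : ∏ i : Fin n, ∑ b : Bool, fv b (z i) * gv b (z' i)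
        = ∑ y : Fin n → Bool, (∏ i, fv (y i) (z i)) * (∏ i, gv (y i) (z' i)) := by
      rw [Finset.prod_univ_sum]
      simp only [Finset.prod_mul_distrib, Fintype.piFinset_univ]
    rw [← this]
    have h2 : ∀ a b : Bool, ∑ c : Bool, fv c a * gv c b = if a = b then 1 else 0 := by
      intro a b; cases a <;> cases b <;> simp [fv, gv]
    simp only [h2]
    by_cases hz : z = z'
    · simp [hz]
    · rw [if_neg hz]
      obtain ⟨i, hi⟩ := Function.ne_iff.mp hz
      exact Finset.prod_eq_zero (Finset.mem_univ i) (by simp [hi])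
  calc _ = ∑ y : Fin n → Bool, ∑ z, ∑ z', (h z * h z') *
        ((∏ i, fv (y i) (z i)) * (∏ i, gv (y i) (z' i))) := by
        refine Finset.sum_congr rfl fun y _ => ?_
        rw [Finset.sum_mul_sum]
        refine Finset.sum_congr rfl fun z _ => Finset.sum_congr rfl fun z' _ => ?_
        ring
    _ = ∑ z, ∑ z', (h z * h z') * ∑ y : Fin n → Bool,
        ((∏ i, fv (y i) (z i)) * (∏ i, gv (y i) (z' i))) := by
        rw [Finset.sum_comm]
        refine Finset.sum_congr rfl fun z _ => ?_
        rw [Finset.sum_comm]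
        refine Finset.sum_congr rfl fun z' _ => ?_
        rw [Finset.mul_sum]
    _ = _ := by
        simp only [h1]
        simp [pow_two]

lemma pair_prod {n : ℕ} (x s y : Fin n → Bool) (f : Bool → Bool → ℚ) :
    ∑ z : Fin n → Bool, (∏ i, ((wv (x i) (s i) (z i) : ℤ) : ℚ)) * ∏ i, f (y i) (z i)
      = ∏ i, ∑ b : Bool, ((wv (x i) (s i) b : ℤ) : ℚ) * f (y i) b := by
  rw [Finset.prod_univ_sum]
  simp only [Finset.prod_mul_distrib, Fintype.piFinset_univ]

/-- Reimer's butterfly inequality. -/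
lemma butterfly {n : ℕ} (C A B : Finset (Fin n → Bool)) (s : (Fin n → Bool) → (Fin n → Bool))
    (hA : ∀ x ∈ C, ∀ y : Fin n → Bool, (∀ i, s x i = true → y i = x i) → y ∈ A)
    (hB : ∀ x ∈ C, ∀ y : Fin n → Bool, (∀ i, s x i = false → y i = !(x i)) → y ∈ B) :
    C.card ≤ (A ∩ B).card := by
  classical
  by_contra hlt
  push Not at hlt
  let L : (C → ℚ) →ₗ[ℚ] ((A ∩ B : Finset (Fin n → Bool)) → ℚ) :=
    Matrix.mulVecLin (Matrix.of fun (y : (A ∩ B : Finset (Fin n → Bool))) (x : C) =>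
      ∑ z : Fin n → Bool, (∏ i, ((wv (x.1 i) (s x.1 i) (z i) : ℤ) : ℚ)) * ∏ i, fv (y.1 i) (z i))
  have hker : LinearMap.ker L ≠ ⊥ := by
    apply LinearMap.ker_ne_bot_of_finrank_lt
    rw [Module.finrank_fintype_fun_eq_card, Module.finrank_fintype_fun_eq_card,
      Fintype.card_coe, Fintype.card_coe]
    exact hlt
  obtain ⟨a, ha, ha0⟩ := (Submodule.ne_bot_iff _).mp hker
  rw [LinearMap.mem_ker] at ha
  let α : (Fin n → Bool) → ℚ := fun x => if hx : x ∈ C then a ⟨x, hx⟩ else 0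
  have hαC : ∀ x, x ∉ C → α x = 0 := fun x hx => by simp [α, hx]
  let h : (Fin n → Bool) → ℚ := fun z => ∑ x, α x * ∏ i, ((wv (x i) (s x i) (z i) : ℤ) : ℚ)
  have hh : ∀ (f : Bool → Bool → ℚ) (y : Fin n → Bool), ∑ z, h z * ∏ i, f (y i) (z i)
      = ∑ x, α x * ∏ i, ∑ b : Bool, ((wv (x i) (s x i) b : ℤ) : ℚ) * f (y i) b := by
    intro f y
    simp only [h, Finset.sum_mul]
    rw [Finset.sum_comm]
    refine Finset.sum_congr rfl fun x _ => ?_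
    rw [← pair_prod, Finset.mul_sum]
    refine Finset.sum_congr rfl fun z _ => ?_
    ring
  have hzero : ∀ y : Fin n → Bool,
      (∑ z, h z * ∏ i, fv (y i) (z i)) * (∑ z, h z * ∏ i, gv (y i) (z i)) = 0 := by
    intro y
    by_cases hyA : y ∈ A
    · by_cases hyB : y ∈ B
      · have hy : y ∈ A ∩ B := Finset.mem_inter.mpr ⟨hyA, hyB⟩
        have := congrFun ha ⟨y, hy⟩
        have h2 : ∑ z, h z * ∏ i, fv (y i) (z i) = 0 := by
          rw [hh]
          simp only [L, Matrix.mulVecLin_apply, Matrix.mulVec, dotProduct, Matrix.of_apply,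
            pair_prod, Pi.zero_apply] at this
          rw [← this, ← Finset.sum_subset (Finset.subset_univ C)
            (fun x _ hx => by rw [hαC x hx, zero_mul]), ← Finset.sum_coe_sort C]
          refine Finset.sum_congr rfl fun x _ => ?_
          have : α x.1 = a x := by simp [α]
          rw [this, mul_comm]
        rw [h2, zero_mul]
      · have h2 : ∑ z, h z * ∏ i, gv (y i) (z i) = 0 := by
          rw [hh]
          refine Finset.sum_eq_zero fun x _ => ?_
          by_cases hx : x ∈ C
          · have : ¬ ∀ i, s x i = false → y i = !(x i) := fun hc => hyB (hB x hx y hc)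
            push Not at this
            obtain ⟨i, hi, hi2⟩ := this
            rw [Finset.prod_eq_zero (Finset.mem_univ i), mul_zero]
            rw [hi]
            revert hi2
            cases x i <;> cases y i <;> simp [wv, gv]
          · rw [hαC x hx, zero_mul]
        rw [h2, mul_zero]
    · have h2 : ∑ z, h z * ∏ i, fv (y i) (z i) = 0 := by
        rw [hh]
        refine Finset.sum_eq_zero fun x _ => ?_
        by_cases hx : x ∈ C
        · have : ¬ ∀ i, s x i = true → y i = x i := fun hc => hyA (hA x hx y hc)
          push Not at this
          obtain ⟨i, hi, hi2⟩ := this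
          rw [Finset.prod_eq_zero (Finset.mem_univ i), mul_zero]
          rw [hi]
          revert hi2
          cases x i <;> cases y i <;> simp [wv, fv]
        · rw [hαC x hx, zero_mul]
      rw [h2, zero_mul]
  have hsq := dual_bases h
  rw [Finset.sum_eq_zero fun y _ => hzero y] at hsq
  have hz : ∀ z, h z = 0 := by
    intro z
    have := (Finset.sum_eq_zero_iff_of_nonneg (fun z _ => sq_nonneg (h z))).mp hsq.symm z
      (Finset.mem_univ z)
    simpa using this
  have hα := rat_indep n s α hz
  apply ha0
  funext x
  have := hα x.1
  simpa [α] using this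

/-- Weight of an event. -/
noncomputable def Pm {n : ℕ} {Ω : Fin n → Type*} [∀ i, Fintype (Ω i)]
    (p : ∀ i, Ω i → ℝ) (E : Set (∀ i, Ω i)) : ℝ :=
  ∑ ω : ∀ i, Ω i, (∏ i, p i (ω i)) * E.indicator 1 ω

/-- Coordinatewise mixture of two points. -/
def mix {n : ℕ} {Ω : Fin n → Type*} (ε : Fin n → Bool) (ω ω' : ∀ i, Ω i) : ∀ i, Ω i :=
  fun i => if ε i then ω i else ω' i

/-- Swapping coordinates of a pair of points. -/
def swapE {n : ℕ} {Ω : Fin n → Type*} (ε : Fin n → Bool) :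
    ((∀ i, Ω i) × (∀ i, Ω i)) ≃ ((∀ i, Ω i) × (∀ i, Ω i)) :=
  Function.Involutive.toPerm
    (fun q => (mix ε q.1 q.2, mix (fun i => !(ε i)) q.1 q.2)) (by
      intro q
      ext i <;> by_cases h : ε i = true <;> simp [mix, h])

lemma swap_sum {n : ℕ} {Ω : Fin n → Type*} [∀ i, Fintype (Ω i)]
    (p : ∀ i, Ω i → ℝ) (ε : Fin n → Bool) (F : (∀ i, Ω i) → (∀ i, Ω i) → ℝ) :
    ∑ q : (∀ i, Ω i) × (∀ i, Ω i), ((∏ i, p i (q.1 i)) * (∏ i, p i (q.2 i))) * F q.1 q.2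
    = ∑ q : (∀ i, Ω i) × (∀ i, Ω i), ((∏ i, p i (q.1 i)) * (∏ i, p i (q.2 i))) *
        F (mix ε q.1 q.2) (mix (fun i => !(ε i)) q.1 q.2) := by
  rw [← (swapE ε).sum_comp]
  refine Finset.sum_congr rfl fun q _ => ?_
  have h1 : (swapE ε q) = (mix ε q.1 q.2, mix (fun i => !(ε i)) q.1 q.2) := rfl
  rw [h1]
  congr 1
  rw [← Finset.prod_mul_distrib, ← Finset.prod_mul_distrib]
  refine Finset.prod_congr rfl fun i _ => ?_
  by_cases h : ε i = true
  · simp [mix, h]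
  · simp [mix, h, mul_comm]

/-- Reimer's inequality. -/
lemma reimer {n : ℕ} {Ω : Fin n → Type*} [∀ i, Fintype (Ω i)]
    (p : ∀ i, Ω i → ℝ) (hp : ∀ i a, 0 ≤ p i a) (hp1 : ∑ ω : ∀ i, Ω i, ∏ i, p i (ω i) = 1)
    (A B D : Set (∀ i, Ω i))
    (hD : ∀ ω ∈ D, ∃ S : Finset (Fin n),
      (∀ ω' : ∀ i, Ω i, (∀ i ∈ S, ω' i = ω i) → ω' ∈ A) ∧
      (∀ ω' : ∀ i, Ω i, (∀ i, i ∉ S → ω' i = ω i) → ω' ∈ B)) :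
    Pm p D ≤ Pm p A * Pm p B := by
  classical
  have hN : (0 : ℝ) < (Fintype.card (Fin n → Bool) : ℝ) := by
    exact_mod_cast Fintype.card_pos
  refine le_of_mul_le_mul_left ?_ hN
  have e1 : Pm p D = ∑ q : (∀ i, Ω i) × (∀ i, Ω i),
      ((∏ i, p i (q.1 i)) * (∏ i, p i (q.2 i))) * D.indicator 1 q.1 := by
    rw [Fintype.sum_prod_type]
    unfold Pm
    refine Finset.sum_congr rfl fun ω _ => ?_
    calc _ = ((∏ i, p i (ω i)) * D.indicator 1 ω) * ∑ ω' : ∀ i, Ω i, ∏ i, p i (ω' i) := by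
            rw [hp1, mul_one]
      _ = _ := by
            rw [Finset.mul_sum]
            refine Finset.sum_congr rfl fun ω' _ => ?_
            ring
  have e2 : Pm p A * Pm p B = ∑ q : (∀ i, Ω i) × (∀ i, Ω i),
      ((∏ i, p i (q.1 i)) * (∏ i, p i (q.2 i))) * (A.indicator 1 q.1 * B.indicator 1 q.2) := by
    rw [Fintype.sum_prod_type]
    unfold Pm
    rw [Finset.sum_mul_sum]
    refine Finset.sum_congr rfl fun ω _ => Finset.sum_congr rfl fun ω' _ => ?_
    ring
  have f1 : (Fintype.card (Fin n → Bool) : ℝ) * Pm p D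
      = ∑ q : (∀ i, Ω i) × (∀ i, Ω i), ((∏ i, p i (q.1 i)) * (∏ i, p i (q.2 i))) *
        ∑ ε : Fin n → Bool, D.indicator 1 (mix ε q.1 q.2) := by
    simp only [Finset.mul_sum]
    rw [Finset.sum_comm]
    rw [Finset.sum_congr rfl fun ε _ =>
      (swap_sum p ε (fun ω _ => D.indicator 1 ω)).symm]
    rw [← e1]
    simp
  have f2 : (Fintype.card (Fin n → Bool) : ℝ) * (Pm p A * Pm p B)
      = ∑ q : (∀ i, Ω i) × (∀ i, Ω i), ((∏ i, p i (q.1 i)) * (∏ i, p i (q.2 i))) *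
        ∑ ε : Fin n → Bool, (A.indicator 1 (mix ε q.1 q.2) *
          B.indicator 1 (mix (fun i => !(ε i)) q.1 q.2)) := by
    simp only [Finset.mul_sum]
    rw [Finset.sum_comm]
    rw [Finset.sum_congr rfl fun ε _ =>
      (swap_sum p ε (fun ω ω' => A.indicator 1 ω * B.indicator 1 ω')).symm]
    rw [← e2]
    simp
  rw [f1, f2]
  refine Finset.sum_le_sum fun q _ => ?_
  refine mul_le_mul_of_nonneg_left ?_ (mul_nonneg (Finset.prod_nonneg fun i _ => hp _ _)
    (Finset.prod_nonneg fun i _ => hp _ _))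
  obtain ⟨ω, ω'⟩ := q
  simp only
  let C : Finset (Fin n → Bool) := Finset.univ.filter fun ε => mix ε ω ω' ∈ D
  let A' : Finset (Fin n → Bool) := Finset.univ.filter fun ε => mix ε ω ω' ∈ A
  let B' : Finset (Fin n → Bool) :=
    Finset.univ.filter fun ε => mix (fun i => !(ε i)) ω ω' ∈ B
  have g1 : ∑ ε : Fin n → Bool, D.indicator (1 : (∀ i, Ω i) → ℝ) (mix ε ω ω')
      = (C.card : ℝ) := by
    simp [C, Set.indicator_apply]
  have g2 : ∑ ε : Fin n → Bool, (A.indicator (1 : (∀ i, Ω i) → ℝ) (mix ε ω ω') *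
      B.indicator 1 (mix (fun i => !(ε i)) ω ω')) = ((A' ∩ B').card : ℝ) := by
    have : A' ∩ B' = Finset.univ.filter fun ε => mix ε ω ω' ∈ A ∧
        mix (fun i => !(ε i)) ω ω' ∈ B := by
      ext ε; simp [A', B']
    rw [this, Finset.card_filter]
    push_cast
    refine Finset.sum_congr rfl fun ε _ => ?_
    by_cases ha : mix ε ω ω' ∈ A <;> by_cases hb : mix (fun i => !(ε i)) ω ω' ∈ B <;>
      simp [ha, hb]
  rw [g1, g2]
  have hS : ∀ ε : Fin n → Bool, ∃ S : Finset (Fin n), ε ∈ C →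
      (∀ τ : ∀ i, Ω i, (∀ i ∈ S, τ i = mix ε ω ω' i) → τ ∈ A) ∧
      (∀ τ : ∀ i, Ω i, (∀ i, i ∉ S → τ i = mix ε ω ω' i) → τ ∈ B) := by
    intro ε
    by_cases hε : ε ∈ C
    · obtain ⟨S, h⟩ := hD (mix ε ω ω') (by simpa [C] using hε)
      exact ⟨S, fun _ => h⟩
    · exact ⟨∅, fun h => absurd h hε⟩
  choose S hS using hS
  have := butterfly C A' B' (fun ε i => decide (i ∈ S ε))
    (by
      intro ε hε y hy
      simp only [A', Finset.mem_filter, Finset.mem_univ, true_and]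
      apply (hS ε hε).1
      intro i hi
      have := hy i (by simpa using hi)
      simp [mix, this])
    (by
      intro ε hε y hy
      simp only [B', Finset.mem_filter, Finset.mem_univ, true_and]
      apply (hS ε hε).2
      intro i hi
      have := hy i (by simpa using hi)
      simp [mix, this])
  exact_mod_cast this

lemma Pm_nonneg {n : ℕ} {Ω : Fin n → Type*} [∀ i, Fintype (Ω i)]
    (p : ∀ i, Ω i → ℝ) (hp : ∀ i a, 0 ≤ p i a) (E : Set (∀ i, Ω i)) : 0 ≤ Pm p E :=
  Finset.sum_nonneg fun ω _ => mul_nonneg (Finset.prod_nonneg fun i _ => hp _ _)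
    (Set.indicator_nonneg (fun _ _ => zero_le_one) _)

lemma Pm_mono {n : ℕ} {Ω : Fin n → Type*} [∀ i, Fintype (Ω i)]
    (p : ∀ i, Ω i → ℝ) (hp : ∀ i a, 0 ≤ p i a) {E F : Set (∀ i, Ω i)} (h : E ⊆ F) :
    Pm p E ≤ Pm p F :=
  Finset.sum_le_sum fun ω _ => mul_le_mul_of_nonneg_left
    (Set.indicator_le_indicator_of_subset h (fun _ => zero_le_one) _)
    (Finset.prod_nonneg fun i _ => hp _ _)

lemma reimer_multi {n : ℕ} {Ω : Fin n → Type*} [∀ i, Fintype (Ω i)]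
    (p : ∀ i, Ω i → ℝ) (hp : ∀ i a, 0 ≤ p i a) (hp1 : ∑ ω : ∀ i, Ω i, ∏ i, p i (ω i) = 1)
    {ι : Type*} [DecidableEq ι] (A : ι → Set (∀ i, Ω i)) (I : Finset ι) :
    Pm p {ω | OccurDisjointly A I ω} ≤ ∏ j ∈ I, Pm p (A j) := by
  induction I using Finset.induction_on with
  | empty =>
    have : Pm p {ω | OccurDisjointly A ∅ ω} ≤ Pm p Set.univ := Pm_mono p hp (Set.subset_univ _)
    simpa [Pm, hp1] using this
  | insert a I ha ih =>
    rw [Finset.prod_insert ha]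
    refine (reimer p hp hp1 (A a) {ω | OccurDisjointly A I ω} _ ?_).trans
      (mul_le_mul_of_nonneg_left ih (Pm_nonneg p hp _))
    rintro ω ⟨S, hdis, hS⟩
    refine ⟨S a, hS a (Finset.mem_insert_self _ _), ?_⟩
    intro ω' hω'
    refine ⟨S, fun j hj j' hj' => hdis j (Finset.mem_insert_of_mem hj) j'
      (Finset.mem_insert_of_mem hj'), ?_⟩
    intro j hj ω'' h''
    refine hS j (Finset.mem_insert_of_mem hj) ω'' fun i hi => ?_
    rw [h'' i hi]
    apply hω'
    intro hia
    exact Finset.disjoint_left.mp (hdis j (Finset.mem_insert_of_mem hj) a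
      (Finset.mem_insert_self _ _) (fun h => ha (h ▸ hj))) hi hia

lemma exists_max {n k : ℕ} {Ω : Fin n → Type*} (A : Fin k → Set (∀ i, Ω i)) (ω : ∀ i, Ω i) :
    ∃ I : Finset (Fin k), I.card = maxDisjOcc A ω ∧ OccurDisjointly A I ω := by
  have := Nat.sSup_mem (s := {m : ℕ | ∃ I : Finset (Fin k), I.card = m ∧ OccurDisjointly A I ω})
    ⟨0, ∅, rfl, fun _ => ∅, by simp, by simp⟩
    ⟨k, by rintro m ⟨I, rfl, -⟩; simpa using Finset.card_le_univ I⟩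
  exact this

lemma exp_moment {n k : ℕ} {Ω : Fin n → Type*} [∀ i, Fintype (Ω i)]
    (p : ∀ i, Ω i → ℝ) (hp : ∀ i a, 0 ≤ p i a) (hp1 : ∑ ω : ∀ i, Ω i, ∏ i, p i (ω i) = 1)
    (A : Fin k → Set (∀ i, Ω i)) (z : ℝ) (hz : 0 ≤ z) :
    ∑ ω : ∀ i, Ω i, (∏ i, p i (ω i)) * (1 + z) ^ (maxDisjOcc A ω)
      ≤ Real.exp (z * ∑ j, Pm p (A j)) := by
  classical
  have h1 : ∀ ω : ∀ i, Ω i, (1 + z) ^ (maxDisjOcc A ω) ≤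
      ∑ J : Finset (Fin k), z ^ J.card *
        ({ω | OccurDisjointly A J ω} : Set (∀ i, Ω i)).indicator 1 ω := by
    intro ω
    obtain ⟨I, hI, S, hdis, hS⟩ := exists_max A ω
    rw [← hI]
    have h2 : (1 + z) ^ I.card = ∑ J ∈ I.powerset, z ^ J.card := by
      have := Finset.prod_one_add (f := fun _ : Fin k => z) I
      simpa using this
    rw [h2]
    calc _ = ∑ J ∈ I.powerset, z ^ J.card *
          ({ω | OccurDisjointly A J ω} : Set (∀ i, Ω i)).indicator 1 ω := by
          refine Finset.sum_congr rfl fun J hJ => ?_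
          rw [Finset.mem_powerset] at hJ
          have : ω ∈ ({ω | OccurDisjointly A J ω} : Set (∀ i, Ω i)) :=
            ⟨S, fun j hj j' hj' => hdis j (hJ hj) j' (hJ hj'), fun j hj => hS j (hJ hj)⟩
          rw [Set.indicator_of_mem this]
          simp
      _ ≤ _ := Finset.sum_le_sum_of_subset_of_nonneg (Finset.subset_univ _)
          fun J _ _ => mul_nonneg (pow_nonneg hz _)
            (Set.indicator_nonneg (fun _ _ => zero_le_one) _)
  calc _ ≤ ∑ ω : ∀ i, Ω i, (∏ i, p i (ω i)) * ∑ J : Finset (Fin k), z ^ J.card *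
        ({ω | OccurDisjointly A J ω} : Set (∀ i, Ω i)).indicator 1 ω :=
        Finset.sum_le_sum fun ω _ => mul_le_mul_of_nonneg_left (h1 ω)
          (Finset.prod_nonneg fun i _ => hp _ _)
    _ = ∑ J : Finset (Fin k), z ^ J.card * Pm p {ω | OccurDisjointly A J ω} := by
        simp only [Pm, Finset.mul_sum]
        rw [Finset.sum_comm]
        refine Finset.sum_congr rfl fun J _ => Finset.sum_congr rfl fun ω _ => ?_
        ring
    _ ≤ ∑ J : Finset (Fin k), z ^ J.card * ∏ j ∈ J, Pm p (A j) :=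
        Finset.sum_le_sum fun J _ => mul_le_mul_of_nonneg_left
          (reimer_multi p hp hp1 A J) (pow_nonneg hz _)
    _ = ∏ j, (1 + z * Pm p (A j)) := by
        rw [Finset.prod_one_add]
        simp [Finset.prod_mul_distrib]
    _ ≤ ∏ j, Real.exp (z * Pm p (A j)) :=
        Finset.prod_le_prod (fun j _ => add_nonneg zero_le_one
          (mul_nonneg hz (Pm_nonneg p hp _))) fun j _ => by
            rw [add_comm]; exact Real.add_one_le_exp _
    _ = _ := by rw [← Real.exp_sum, Finset.mul_sum]

lemma pi_eq_Pm {n : ℕ} {Ω : Fin n → Type*} [∀ i, Fintype (Ω i)]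
    [∀ i, MeasurableSpace (Ω i)] [∀ i, MeasurableSingletonClass (Ω i)]
    (μi : ∀ i, Measure (Ω i)) [∀ i, IsProbabilityMeasure (μi i)] (E : Set (∀ i, Ω i)) :
    (Measure.pi μi E).toReal = Pm (fun i a => (μi i {a}).toReal) E := by
  classical
  have h := MeasureTheory.sum_measureReal_singleton (μ := Measure.pi μi)
    (Finset.univ.filter fun ω => ω ∈ E)
  simp only [Finset.coe_filter, Finset.mem_univ, true_and, Set.ofPred_mem_eq] at h
  change (Measure.pi μi).real E = _
  rw [← h, Finset.sum_filter]
  unfold Pm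
  refine Finset.sum_congr rfl fun ω _ => ?_
  by_cases hω : ω ∈ E
  · simp [hω, Measure.real, Measure.pi_singleton, ENNReal.toReal_prod]
  · simp [hω]

end ReimerAux

/-- **Chernoff-type upper tail bound for disjoint occurrence of arbitrary events
in a product of linearly ordered spaces.** If each factor `Ω i` is linearly
ordered, `A 1, …, A k` are arbitrary events, `X` is the maximal number of them
occurring disjointly, and `λ = Σ μ(A i)`, then for `t ≥ 0`,
`Pr(X ≥ λ + t) ≤ exp(−λ φ(t/λ))`. -/
theorem extended_BK_chernoff_linear
    {n k : ℕ} {Ω : Fin n → Type*}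
    [∀ i, Fintype (Ω i)] [∀ i, LinearOrder (Ω i)]
    [∀ i, MeasurableSpace (Ω i)] [∀ i, MeasurableSingletonClass (Ω i)]
    (μi : ∀ i, Measure (Ω i)) [∀ i, IsProbabilityMeasure (μi i)]
    (A : Fin k → Set (∀ i, Ω i))
    (lam : ℝ) (hlam : lam = ∑ i, (Measure.pi μi (A i)).toReal) :
    ∀ t : ℝ, 0 ≤ t →
      (Measure.pi μi {ω | lam + t ≤ (maxDisjOcc A ω : ℝ)}).toReal ≤
        Real.exp (-(lam * chernoffPhi (t / lam))) := by
  open ReimerAux in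
  intro t ht
  have hle1 : (Measure.pi μi {ω | lam + t ≤ (maxDisjOcc A ω : ℝ)}).toReal ≤ 1 :=
    measureReal_le_one
  have hlam0 : 0 ≤ lam := by
    rw [hlam]; exact Finset.sum_nonneg fun i _ => ENNReal.toReal_nonneg
  rcases hlam0.eq_or_lt with h0 | hpos
  · rw [← h0] at hle1 ⊢
    simpa using hle1
  set p : ∀ i, Ω i → ℝ := fun i a => (μi i {a}).toReal with hpdef
  have hp : ∀ i a, 0 ≤ p i a := fun i a => ENNReal.toReal_nonneg
  have hp1 : ∑ ω : ∀ i, Ω i, ∏ i, p i (ω i) = 1 := by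
    have := pi_eq_Pm μi Set.univ
    simpa [Pm] using this.symm
  simp only [pi_eq_Pm μi] at hlam ⊢
  have hz : 0 ≤ t / lam := div_nonneg ht hpos.le
  have h1z : 0 < 1 + t / lam := by linarith
  have hm := exp_moment p hp hp1 A (t / lam) hz
  rw [← hlam, div_mul_cancel₀ _ hpos.ne'] at hm
  have hmk : Real.exp ((lam + t) * Real.log (1 + t / lam)) *
      Pm p {ω | lam + t ≤ (maxDisjOcc A ω : ℝ)} ≤ Real.exp t := by
    refine le_trans ?_ hm
    unfold Pm
    rw [Finset.mul_sum]
    refine Finset.sum_le_sum fun ω _ => ?_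
    have hW : 0 ≤ ∏ i, p i (ω i) := Finset.prod_nonneg fun i _ => hp _ _
    by_cases hω : ω ∈ {ω | lam + t ≤ (maxDisjOcc A ω : ℝ)}
    · rw [Set.indicator_of_mem hω, Pi.one_apply, mul_one, mul_comm]
      refine mul_le_mul_of_nonneg_left ?_ hW
      rw [← Real.exp_log (pow_pos h1z _), Real.log_pow]
      apply Real.exp_le_exp.mpr
      exact mul_le_mul_of_nonneg_right hω (Real.log_nonneg (by linarith))
    · rw [Set.indicator_of_notMem hω, mul_zero, mul_zero]
      exact mul_nonneg hW (pow_nonneg h1z.le _)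
  have hfin : Real.exp (-(lam * chernoffPhi (t / lam)))
      = Real.exp t / Real.exp ((lam + t) * Real.log (1 + t / lam)) := by
    rw [← Real.exp_sub]
    congr 1
    have e1 : lam * (t / lam) = t := mul_div_cancel₀ _ hpos.ne'
    unfold chernoffPhi
    linear_combination (1 - Real.log (1 + t / lam)) * e1
  rw [hfin, le_div_iff₀ (Real.exp_pos _), mul_comm]
  exact hmk
end

section
/- Let (Ω,μ) = ∏_{i=1}^n (Ω_i,μ_i) be a finite product probability space in which each factor Ω_i is linearly ordered. Then for any finite family of events {A_i}_{i∈I} in Ω, μ(□_{i∈I} A_i) ≤ ∏_{i∈I} μ(A_i). -/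
open MeasureTheory

/-- Tensor power of a `2 × 2` matrix, indexed by the cube. -/
noncomputable def tens (n : ℕ) (g : Matrix Bool Bool ℝ) :
    Matrix (Fin n → Bool) (Fin n → Bool) ℝ :=
  Matrix.of fun z w => ∏ i, g (z i) (w i)

lemma tens_mulVec_prod (n : ℕ) (g : Matrix Bool Bool ℝ) (a : Fin n → Bool → ℝ)
    (z : Fin n → Bool) :
    (tens n g).mulVec (fun w => ∏ i, a i (w i)) z = ∏ i, ∑ b, g (z i) b * a i b := by
  classical
  simp only [Matrix.mulVec, dotProduct, tens, Matrix.of_apply, ← Finset.prod_mul_distrib]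
  rw [Finset.prod_univ_sum, Fintype.piFinset_univ]

lemma tens_mul (n : ℕ) (g h : Matrix Bool Bool ℝ) :
    tens n g * tens n h = tens n (g * h) := by
  ext z w
  have := tens_mulVec_prod n g (fun i b => h b (w i)) z
  simpa [Matrix.mul_apply, Matrix.mulVec, dotProduct, tens] using this

lemma tens_one (n : ℕ) : tens n 1 = 1 := by
  ext z w
  by_cases h : z = w
  · subst h; simp [tens]
  · obtain ⟨i, hi⟩ := Function.ne_iff.mp h
    rw [Matrix.one_apply_ne h]
    simp only [tens, Matrix.of_apply]
    exact Finset.prod_eq_zero (Finset.mem_univ i) (Matrix.one_apply_ne hi)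

lemma tens_transpose (n : ℕ) (g : Matrix Bool Bool ℝ) :
    (tens n g).transpose = tens n g.transpose := by
  ext z w
  simp [tens]

/-- The symmetric matrix `[[ε, 1], [1, ε]]`. -/
def locL (e d : ℝ) : Matrix Bool Bool ℝ := Matrix.of fun a b => if a = b then e else d

lemma tens_posdef (n : ℕ) (e : ℝ) (he : 1 < e) (v : (Fin n → Bool) → ℝ)
    (hv : ∑ z, v z * (tens n (locL e 1)).mulVec v z = 0) : v = 0 := by
  set p := (√(e + 1) + √(e - 1)) / 2 with hp
  set q := (√(e + 1) - √(e - 1)) / 2 with hq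
  have h1 : √(e + 1) ^ 2 = e + 1 := Real.sq_sqrt (by linarith)
  have h2 : √(e - 1) ^ 2 = e - 1 := Real.sq_sqrt (by linarith)
  have hpq1 : p * p + q * q = e := by rw [hp, hq]; nlinarith
  have hpq2 : p * q + q * p = 1 := by rw [hp, hq]; nlinarith
  set r := √(e + 1) * √(e - 1) with hr
  have hpq3 : p * p - q * q = r := by rw [hp, hq, hr]; ring
  have hr0 : r ≠ 0 := by
    have : 0 < r := mul_pos (Real.sqrt_pos.mpr (by linarith)) (Real.sqrt_pos.mpr (by linarith))
    exact this.ne'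
  have hL : locL p q * locL p q = locL e 1 := by
    ext a b
    cases a <;> cases b <;> simp [locL, Matrix.mul_apply] <;> linarith
  have hinv : locL (p / r) (-q / r) * locL p q = 1 := by
    ext a b
    cases a <;> cases b <;> simp [locL, Matrix.mul_apply] <;> field_simp <;>
      linarith
  have hsymm : (locL p q).transpose = locL p q := by
    ext a b
    cases a <;> cases b <;> simp [locL]
  set u := (tens n (locL p q)).mulVec v with hu
  have h0 : ∑ z, u z * u z = 0 := by
    have h3 : dotProduct v ((tens n (locL e 1)).mulVec v) = 0 := hv
    rw [← hL, ← tens_mul, ← Matrix.mulVec_mulVec, Matrix.dotProduct_mulVec,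
      ← Matrix.mulVec_transpose, tens_transpose, hsymm] at h3
    exact h3
  have hu0 : u = 0 := by
    ext z
    have := (Finset.sum_eq_zero_iff_of_nonneg (fun z _ => mul_self_nonneg (u z))).mp h0 z
      (Finset.mem_univ z)
    simpa using this
  calc v = (tens n (locL (p / r) (-q / r))).mulVec u := by
        rw [hu, Matrix.mulVec_mulVec, tens_mul, hinv, tens_one, Matrix.one_mulVec]
    _ = 0 := by rw [hu0, Matrix.mulVec_zero]

/-- Local factor of the vector attached to a butterfly. -/
def locA {R : Type*} [CommRing R] (t : R) (inS : Prop) [Decidable inS] (x w : Bool) : R :=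
  if w = x then 1 else if inS then 0 else -t

/-- The matrix whose rows are the butterfly vectors. -/
def matA {n : ℕ} {R : Type*} [CommRing R] (s : (Fin n → Bool) → Finset (Fin n)) (t : R) :
    Matrix (Fin n → Bool) (Fin n → Bool) R :=
  Matrix.of fun x z => ∏ i, locA t (i ∈ s x) (x i) (z i)

lemma matA_zero {n : ℕ} (s : (Fin n → Bool) → Finset (Fin n)) : matA s (0 : ℝ) = 1 := by
  ext x z
  by_cases h : x = z
  · subst h; simp [matA, locA]
  · obtain ⟨i, hi⟩ := Function.ne_iff.mp h
    rw [Matrix.one_apply_ne h]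
    simp only [matA, Matrix.of_apply]
    refine Finset.prod_eq_zero (Finset.mem_univ i) ?_
    simp [locA, hi.symm]

lemma matA_map {n : ℕ} (s : (Fin n → Bool) → Finset (Fin n)) (t : ℝ) :
    (Polynomial.evalRingHom t).mapMatrix (matA s (Polynomial.X : Polynomial ℝ)) = matA s t := by
  ext x z
  simp only [matA, RingHom.mapMatrix_apply, Matrix.map_apply, Matrix.of_apply, map_prod]
  refine Finset.prod_congr rfl fun i _ => ?_
  unfold locA
  split_ifs <;> simp

lemma exists_good {n : ℕ} (s : (Fin n → Bool) → Finset (Fin n)) :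
    ∃ e : ℝ, 1 < e ∧ (matA s e).det ≠ 0 := by
  set P := (matA s (Polynomial.X : Polynomial ℝ)).det with hP
  have hev : ∀ t : ℝ, P.eval t = (matA s t).det := by
    intro t
    rw [← matA_map s t, ← RingHom.map_det]
    rfl
  have hP0 : P ≠ 0 := by
    intro h
    have := hev 0
    rw [h, matA_zero] at this
    simp at this
  have hinf : (Set.Ioi (1 : ℝ) \ {t | P.IsRoot t}).Nonempty := by
    refine Set.Infinite.nonempty (Set.Infinite.sdiff (Set.Ioi_infinite 1) ?_)
    exact Polynomial.finite_setOfPred_isRoot hP0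
  obtain ⟨e, he, hne⟩ := hinf
  refine ⟨e, he, ?_⟩
  rw [← hev]
  exact hne

/-- Reimer's butterfly theorem. -/
lemma butterfly {n : ℕ} (s : (Fin n → Bool) → Finset (Fin n)) (X A B : Finset (Fin n → Bool))
    (hA : ∀ x ∈ X, ∀ z, (∀ i ∈ s x, z i = x i) → z ∈ A)
    (hB : ∀ x ∈ X, ∀ z, (∀ i, i ∉ s x → z i = !(x i)) → z ∈ B) :
    X.card ≤ (A ∩ B).card := by
  classical
  obtain ⟨e, he, hdet⟩ := exists_good s
  set M := matA s e with hM
  have hli : LinearIndependent ℝ (fun x => M x) :=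
    Matrix.linearIndependent_rows_of_det_ne_zero hdet
  have hliX : LinearIndependent ℝ (fun x : X => M x.1) := hli.comp _ Subtype.val_injective
  have hMA : ∀ x ∈ X, ∀ z, z ∉ A → M x z = 0 := by
    intro x hx z hz
    have : ¬ ∀ i ∈ s x, z i = x i := fun h => hz (hA x hx z h)
    push Not at this
    obtain ⟨i, hi, hne⟩ := this
    simp only [hM, matA, Matrix.of_apply]
    refine Finset.prod_eq_zero (Finset.mem_univ i) ?_
    simp [locA, hi, hne]
  have hMB : ∀ x ∈ X, ∀ z, z ∉ B → (tens n (locL e 1)).mulVec (M x) z = 0 := by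
    intro x hx z hz
    have : ¬ ∀ i, i ∉ s x → z i = !(x i) := fun h => hz (hB x hx z h)
    push Not at this
    obtain ⟨i, hi, hne⟩ := this
    have h := tens_mulVec_prod n (locL e 1) (fun i b => locA e (i ∈ s x) (x i) b) z
    have h' : (tens n (locL e 1)).mulVec (M x) z = _ := h
    rw [h']
    refine Finset.prod_eq_zero (Finset.mem_univ i) ?_
    simp only [Fintype.sum_bool, locL, locA, Matrix.of_apply, hi, if_false]
    revert hne
    cases z i <;> cases x i <;> simp
  let φ : (X → ℝ) →ₗ[ℝ] ((A ∩ B : Finset _) → ℝ) :=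
    (LinearMap.funLeft ℝ ℝ (fun z : (A ∩ B : Finset (Fin n → Bool)) => z.1)) ∘ₗ
      (Fintype.linearCombination ℝ (fun x : X => M x.1))
  have hinj : Function.Injective φ := by
    rw [injective_iff_map_eq_zero]
    intro c hc
    set v := Fintype.linearCombination ℝ (fun x : X => M x.1) c with hv
    have hvsum : v = ∑ x : X, c x • M x.1 := Fintype.linearCombination_apply ..
    have hv0 : v = 0 := by
      refine tens_posdef n e he v (Finset.sum_eq_zero fun z _ => ?_)
      by_cases hzA : z ∈ A
      · by_cases hzB : z ∈ B
        · have := congrFun hc ⟨z, Finset.mem_inter.mpr ⟨hzA, hzB⟩⟩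
          have h : v z = 0 := this
          rw [h, zero_mul]
        · have : (tens n (locL e 1)).mulVec v z = 0 := by
            rw [hvsum, Matrix.mulVec_sum, Finset.sum_apply]
            refine Finset.sum_eq_zero fun x _ => ?_
            rw [Matrix.mulVec_smul, Pi.smul_apply, hMB x.1 x.2 z hzB, smul_zero]
          rw [this, mul_zero]
      · have : v z = 0 := by
          rw [hvsum, Finset.sum_apply]
          refine Finset.sum_eq_zero fun x _ => ?_
          rw [Pi.smul_apply, hMA x.1 x.2 z hzA, smul_zero]
        rw [this, zero_mul]
    rw [hvsum] at hv0
    ext x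
    exact Fintype.linearIndependent_iff.mp hliX c hv0 x
  have := LinearMap.finrank_le_finrank_of_injective hinj
  rwa [Module.finrank_fintype_fun_eq_card, Module.finrank_fintype_fun_eq_card,
    Fintype.card_coe, Fintype.card_coe] at this

/-- Disjoint occurrence of two events. -/
def box2 {n : ℕ} {Ω : Fin n → Type*} (A B : Set (∀ i, Ω i)) : Set (∀ i, Ω i) :=
  {ω | ∃ S : Finset (Fin n), (∀ ω' : ∀ i, Ω i, (∀ i ∈ S, ω' i = ω i) → ω' ∈ A) ∧
    (∀ ω' : ∀ i, Ω i, (∀ i, i ∉ S → ω' i = ω i) → ω' ∈ B)}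

/-- Choose coordinate `i` from the first point if `z i`, otherwise from the second. -/
def mix {n : ℕ} {Ω : Fin n → Type*} (z : Fin n → Bool) (a b : ∀ i, Ω i) : ∀ i, Ω i :=
  fun i => if z i then a i else b i

open Classical in
lemma mix_card {n : ℕ} {Ω : Fin n → Type*} (A B : Set (∀ i, Ω i)) (a b : ∀ i, Ω i) :
    (Finset.univ.filter fun z => mix z a b ∈ box2 A B).card ≤
    (Finset.univ.filter fun z => mix z a b ∈ A ∧ mix z b a ∈ B).card := by
  have hex : ∀ z : Fin n → Bool, ∃ S : Finset (Fin n), mix z a b ∈ box2 A B →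
      (∀ ω' : ∀ i, Ω i, (∀ i ∈ S, ω' i = mix z a b i) → ω' ∈ A) ∧
      (∀ ω' : ∀ i, Ω i, (∀ i, i ∉ S → ω' i = mix z a b i) → ω' ∈ B) := by
    intro z
    by_cases h : mix z a b ∈ box2 A B
    · obtain ⟨S, hS⟩ := h
      exact ⟨S, fun _ => hS⟩
    · exact ⟨∅, fun h' => absurd h' h⟩
  choose s hs using hex
  rw [Finset.filter_and]
  refine butterfly s _ _ _ ?_ ?_
  · intro x hx z hz
    rw [Finset.mem_filter] at hx ⊢
    refine ⟨Finset.mem_univ _, (hs x hx.2).1 _ fun i hi => ?_⟩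
    simp only [mix, hz i hi]
  · intro x hx z hz
    rw [Finset.mem_filter] at hx ⊢
    refine ⟨Finset.mem_univ _, (hs x hx.2).2 _ fun i hi => ?_⟩
    simp only [mix, hz i hi]
    cases x i <;> simp

/-- Swapping coordinates of a pair of points. -/
def mixEquiv {n : ℕ} {Ω : Fin n → Type*} (z : Fin n → Bool) :
    ((∀ i, Ω i) × (∀ i, Ω i)) ≃ ((∀ i, Ω i) × (∀ i, Ω i)) where
  toFun p := (mix z p.1 p.2, mix z p.2 p.1)
  invFun p := (mix z p.1 p.2, mix z p.2 p.1)
  left_inv p := by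
    ext i <;> simp only [mix] <;> cases z i <;> simp
  right_inv p := by
    ext i <;> simp only [mix] <;> cases z i <;> simp

lemma avg_swap {n : ℕ} {Ω : Fin n → Type*} [∀ i, Fintype (Ω i)] (m : ∀ i, Ω i → ENNReal)
    (E : (∀ i, Ω i) → (∀ i, Ω i) → Prop)
    [∀ a b, Decidable (E a b)] :
    (2 : ENNReal) ^ n * ∑ p : (∀ i, Ω i) × (∀ i, Ω i),
      (∏ i, m i (p.1 i)) * (∏ i, m i (p.2 i)) * (if E p.1 p.2 then 1 else 0) =
    ∑ p : (∀ i, Ω i) × (∀ i, Ω i), (∏ i, m i (p.1 i)) * (∏ i, m i (p.2 i)) *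
      (Finset.univ.filter fun z => E (mix z p.1 p.2) (mix z p.2 p.1)).card := by
  have h1 : ∀ z : Fin n → Bool, ∑ p : (∀ i, Ω i) × (∀ i, Ω i),
      (∏ i, m i (p.1 i)) * (∏ i, m i (p.2 i)) * (if E p.1 p.2 then 1 else 0) =
      ∑ p : (∀ i, Ω i) × (∀ i, Ω i), (∏ i, m i (p.1 i)) * (∏ i, m i (p.2 i)) *
        (if E (mix z p.1 p.2) (mix z p.2 p.1) then 1 else 0) := by
    intro z
    rw [← Equiv.sum_comp (mixEquiv z)]
    refine Finset.sum_congr rfl fun p _ => ?_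
    congr 1
    rw [← Finset.prod_mul_distrib, ← Finset.prod_mul_distrib]
    refine Finset.prod_congr rfl fun i _ => ?_
    simp only [mixEquiv, Equiv.coe_fn_mk, mix]
    cases z i <;> simp [mul_comm]
  have h2 : ((2 : ENNReal) ^ n) = ∑ _z : Fin n → Bool, 1 := by
    simp
  rw [h2, Finset.sum_mul]
  simp_rw [one_mul]
  rw [Finset.sum_congr rfl fun z _ => h1 z, Finset.sum_comm]
  refine Finset.sum_congr rfl fun p _ => ?_
  rw [← Finset.mul_sum, Finset.sum_boole]

lemma pi_sum {n : ℕ} {Ω : Fin n → Type*}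
    [∀ i, Fintype (Ω i)]
    [∀ i, MeasurableSpace (Ω i)] [∀ i, MeasurableSingletonClass (Ω i)]
    (μi : ∀ i, Measure (Ω i)) [∀ i, IsProbabilityMeasure (μi i)] (A : Set (∀ i, Ω i))
    [DecidablePred (· ∈ A)] :
    Measure.pi μi A = ∑ ω, (∏ i, μi i {ω i}) * (if ω ∈ A then 1 else 0) := by
  have h := sum_measure_singleton (μ := Measure.pi μi) (s := Finset.univ.filter (· ∈ A))
  simp only [Finset.coe_filter, Finset.mem_univ, true_and, Set.ofPred_mem_eq] at h
  rw [← h, Finset.sum_filter]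
  refine Finset.sum_congr rfl fun ω _ => ?_
  rw [Measure.pi_singleton]
  simp

lemma reimer_two {n : ℕ} {Ω : Fin n → Type*}
    [∀ i, Fintype (Ω i)]
    [∀ i, MeasurableSpace (Ω i)] [∀ i, MeasurableSingletonClass (Ω i)]
    (μi : ∀ i, Measure (Ω i)) [∀ i, IsProbabilityMeasure (μi i)] (A B : Set (∀ i, Ω i)) :
    Measure.pi μi (box2 A B) ≤ Measure.pi μi A * Measure.pi μi B := by
  classical
  have hL : Measure.pi μi (box2 A B) = ∑ p : (∀ i, Ω i) × (∀ i, Ω i),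
      (∏ i, μi i {p.1 i}) * (∏ i, μi i {p.2 i}) * (if p.1 ∈ box2 A B then 1 else 0) := by
    have h1 : Measure.pi μi (box2 A B) =
        Measure.pi μi (box2 A B) * Measure.pi μi (Set.univ : Set (∀ i, Ω i)) := by
      rw [measure_univ, mul_one]
    rw [h1, pi_sum μi (box2 A B), pi_sum μi Set.univ, Finset.sum_mul_sum, Fintype.sum_prod_type]
    refine Finset.sum_congr rfl fun a _ => Finset.sum_congr rfl fun b _ => ?_
    simp only [Set.mem_univ, if_true]
    ring
  have hR : Measure.pi μi A * Measure.pi μi B = ∑ p : (∀ i, Ω i) × (∀ i, Ω i),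
      (∏ i, μi i {p.1 i}) * (∏ i, μi i {p.2 i}) * (if p.1 ∈ A ∧ p.2 ∈ B then 1 else 0) := by
    rw [pi_sum μi A, pi_sum μi B, Finset.sum_mul_sum, Fintype.sum_prod_type]
    refine Finset.sum_congr rfl fun a _ => Finset.sum_congr rfl fun b _ => ?_
    by_cases ha : a ∈ A <;> by_cases hb : b ∈ B <;> simp [ha, hb]
  have h2 : (2 : ENNReal) ^ n ≠ 0 := by simp
  have h3 : (2 : ENNReal) ^ n ≠ ⊤ := by simp
  rw [← ENNReal.mul_le_mul_iff_right h2 h3, hL, hR]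
  rw [avg_swap (fun i x => μi i {x}) (fun a _ => a ∈ box2 A B),
    avg_swap (fun i x => μi i {x}) (fun a b => a ∈ A ∧ b ∈ B)]
  refine Finset.sum_le_sum fun p _ => ?_
  refine mul_le_mul_right (Nat.cast_le.mpr ?_) _
  convert mix_card A B p.1 p.2

/-- **Reimer's inequality, iterated.** In a finite product probability space whose
factors are linearly ordered, the probability that finitely many events occur
disjointly is at most the product of their probabilities. -/
theorem reimer_many_events
    {n : ℕ} {Ω : Fin n → Type*}
    [∀ i, Fintype (Ω i)] [∀ i, LinearOrder (Ω i)]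
    [∀ i, MeasurableSpace (Ω i)] [∀ i, MeasurableSingletonClass (Ω i)]
    (μi : ∀ i, Measure (Ω i)) [∀ i, IsProbabilityMeasure (μi i)]
    {ι : Type*} (I : Finset ι) (A : ι → Set (∀ i, Ω i)) :
    Measure.pi μi {ω | OccurDisjointly A I ω} ≤ ∏ i ∈ I, Measure.pi μi (A i) := by
  classical
  induction I using Finset.induction_on with
  | empty => simpa using prob_le_one
  | insert a I ha ih =>
    rw [Finset.prod_insert ha]
    refine le_trans (measure_mono ?_) ((reimer_two μi (A a) {ω | OccurDisjointly A I ω}).trans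
      (by gcongr))
    rintro ω ⟨S, hd, hS⟩
    refine ⟨S a, hS a (Finset.mem_insert_self a I), fun ω' h' => ⟨S, ?_, ?_⟩⟩
    · exact fun j hj j' hj' =>
        hd j (Finset.mem_insert_of_mem hj) j' (Finset.mem_insert_of_mem hj')
    · intro j hj ω'' h''
      refine hS j (Finset.mem_insert_of_mem hj) ω'' fun i hi => ?_
      rw [h'' i hi]
      refine h' i fun hia => ?_
      have hja : j ≠ a := fun h => ha (h ▸ hj)
      exact Finset.disjoint_left.mp (hd j (Finset.mem_insert_of_mem hj) a
        (Finset.mem_insert_self a I) hja) hi hia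
end

section
/- Let (Ω,μ) = ∏_{i=1}^n (Ω_i,μ_i) be a finite product probability space in which each factor Ω_i is linearly ordered, let A_1,…,A_k ⊆ Ω be events, and set λ = Σ_{i=1}^k μ(A_i). Then for every integer r with 0 ≤ r ≤ k, r! · Σ_{I ⊆ [k], |I| = r} μ(□_{i∈I} A_i) ≤ λ^r. -/
open MeasureTheory

namespace BKR

/-! The proof goes through Reimer's theorem. -/

/-- The vectors attached to a coordinate: first argument is the bit of `x`, second is `true`
when the coordinate is not in the set `S`. -/
def gv : Bool → Bool → Bool → ℤ
  | false, false, false => 1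
  | false, false, true => 0
  | false, true, false => 0
  | false, true, true => 1
  | true, false, false => 1
  | true, false, true => 1
  | true, true, false => 1
  | true, true, true => -1

def av : Bool → Bool → Bool → ℤ
  | false, false, false => 1
  | false, false, true => 0
  | true, false, false => 0
  | true, false, true => 1
  | false, true, false => -1
  | false, true, true => 1
  | true, true, false => 2
  | true, true, true => -1

def bv : Bool → Bool → Bool → ℤ
  | false, false, false => 1
  | false, false, true => 1
  | true, false, false => 1
  | true, false, true => 2
  | false, true, false => 0
  | false, true, true => 1
  | true, true, false => 1
  | true, true, true => 0

lemma ab_eq_gg (x s y t : Bool) :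
    ∑ z, av x s z * bv y t z = ∑ z, gv x s z * gv y t z := by
  revert x s y t; decide

/-- The test functionals for the triangularity argument modulo two. -/
def tv : Bool → Bool → ZMod 2
  | true, true => 0
  | _, _ => 1

lemma tv_zero (s t : Bool) (x : Bool) : ∑ z, tv x z * ((gv true s z : ℤ) : ZMod 2) = if x then 1 else 0 := by
  revert s t x; decide

lemma tv_diag (s : Bool) (x : Bool) : (x = true → True) →
    ∑ z, tv x z * ((gv x s z : ℤ) : ZMod 2) = 1 := by
  revert s x; decide

variable {ι : Type*} [Fintype ι] [DecidableEq ι]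

lemma prod_sum_bool {R : Type*} [CommRing R] (p q : ι → Bool → R) :
    ∑ z : ι → Bool, (∏ i, p i (z i)) * (∏ i, q i (z i)) = ∏ i, ∑ b, p i b * q i b := by
  rw [Finset.prod_univ_sum, Fintype.piFinset_univ]
  simp only [Finset.prod_mul_distrib]

/-- The matrix of the vectors `g_x`. -/
def G (S : (ι → Bool) → ι → Bool) : Matrix (ι → Bool) (ι → Bool) ℤ :=
  Matrix.of fun z x => ∏ i, gv (x i) (S x i) (z i)

lemma det_G_mod (S : (ι → Bool) → ι → Bool) :
    ((G S).map (Int.castRingHom (ZMod 2))).det ≠ 0 := by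
  intro h
  obtain ⟨c, hc0, hc⟩ := Matrix.exists_mulVec_eq_zero_iff.mpr h
  apply hc0
  have key : ∀ x : ι → Bool, ∑ y, (∏ i, ∑ b, tv (x i) b * ((gv (y i) (S y i) b : ℤ) : ZMod 2)) * c y = 0 := by
    intro x
    simp_rw [← prod_sum_bool, Finset.sum_mul]
    rw [Finset.sum_comm]
    apply Finset.sum_eq_zero
    intro z _
    have hz := congrFun hc z
    simp only [Matrix.mulVec, dotProduct, Matrix.map_apply, G, Matrix.of_apply, Pi.zero_apply] at hz
    simp only [mul_assoc]
    rw [← Finset.mul_sum]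
    simp only [map_prod, eq_intCast] at hz
    rw [hz, mul_zero]
  have ind : ∀ x : ι → Bool, c x = 0 := by
    intro x
    induction x using WellFoundedLT.induction with
    | ind x ih =>
      have hx := key x
      rw [Finset.sum_eq_single x] at hx
      · rw [Finset.prod_eq_one, one_mul] at hx
        · exact hx
        · intro i _
          exact tv_diag _ _ (fun _ => trivial)
      · intro y _ hyx
        by_cases hle : y ≤ x
        · rw [ih y (lt_of_le_of_ne hle hyx), mul_zero]
        · rw [Pi.le_def] at hle
          push Not at hle
          obtain ⟨i, hi⟩ := hle
          rw [Finset.prod_eq_zero (Finset.mem_univ i), zero_mul]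
          have h1 : y i = true ∧ x i = false := by
            revert hi; cases y i <;> cases x i <;> simp
          rw [h1.1, h1.2, tv_zero _ true]; simp
      · simp
  funext x; exact ind x

lemma indep_G (S : (ι → Bool) → ι → Bool) (c : (ι → Bool) → ℝ)
    (h : ∀ z : ι → Bool, ∑ x, c x * ((∏ i, gv (x i) (S x i) (z i) : ℤ) : ℝ) = 0) : c = 0 := by
  have h2 : (G S).det ≠ 0 := by
    intro h0
    apply det_G_mod S
    have := (Int.castRingHom (ZMod 2)).map_det (G S)
    rw [h0, map_zero] at this
    exact this.symm
  have h3 : ((G S).map (Int.castRingHom ℝ)).det ≠ 0 := by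
    have := (Int.castRingHom ℝ).map_det (G S)
    intro h0
    apply h2
    have h4 : (Int.castRingHom ℝ) (G S).det = 0 := this.trans h0
    simpa using h4
  refine Matrix.eq_zero_of_mulVec_eq_zero h3 ?_
  funext z
  rw [Pi.zero_apply, ← h z]
  simp only [Matrix.mulVec, dotProduct, Matrix.map_apply, G, Matrix.of_apply]
  refine Finset.sum_congr rfl fun x _ => ?_
  rw [mul_comm]; simp

lemma inner_eq (x s y t : ι → Bool) :
    ∑ z : ι → Bool, ((∏ i, av (x i) (s i) (z i) : ℤ) : ℝ) * ((∏ i, bv (y i) (t i) (z i) : ℤ) : ℝ)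
     = ∑ z : ι → Bool, ((∏ i, gv (x i) (s i) (z i) : ℤ) : ℝ) * ((∏ i, gv (y i) (t i) (z i) : ℤ) : ℝ) := by
  have := prod_sum_bool (fun i => av (x i) (s i)) (fun i => bv (y i) (t i))
  have h2 := prod_sum_bool (fun i => gv (x i) (s i)) (fun i => gv (y i) (t i))
  simp only [ab_eq_gg] at this
  have h3 := this.trans h2.symm
  exact_mod_cast h3

/-- Reimer's butterfly theorem. -/
lemma butterfly (C : Finset (ι → Bool)) (S : (ι → Bool) → ι → Bool)
    (R Y : Finset (ι → Bool))
    (hR : ∀ x ∈ C, ∀ z : ι → Bool, (∀ i, S x i = false → z i = x i) → z ∈ R)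
    (hY : ∀ x ∈ C, ∀ z : ι → Bool, (∀ i, S x i = true → z i = !x i) → z ∈ Y) :
    C.card ≤ (R ∩ Y).card := by
  let a : (ι → Bool) → (ι → Bool) → ℝ := fun x z => ((∏ i, av (x i) (S x i) (z i) : ℤ) : ℝ)
  let b : (ι → Bool) → (ι → Bool) → ℝ := fun x z => ((∏ i, bv (x i) (S x i) (z i) : ℤ) : ℝ)
  let g : (ι → Bool) → (ι → Bool) → ℝ := fun x z => ((∏ i, gv (x i) (S x i) (z i) : ℤ) : ℝ)
  have ha : ∀ x ∈ C, ∀ z, z ∉ R → a x z = 0 := by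
    intro x hx z hz
    by_contra hne
    refine hz (hR x hx z fun i hi => ?_)
    by_contra hzi
    apply hne
    have : av (x i) (S x i) (z i) = 0 := by
      rw [hi]; revert hzi; cases x i <;> cases z i <;> simp [av]
    simp only [a]
    rw [Finset.prod_eq_zero (Finset.mem_univ i) this]; simp
  have hb : ∀ x ∈ C, ∀ z, z ∉ Y → b x z = 0 := by
    intro x hx z hz
    by_contra hne
    refine hz (hY x hx z fun i hi => ?_)
    by_contra hzi
    apply hne
    have : bv (x i) (S x i) (z i) = 0 := by
      rw [hi]; revert hzi; cases x i <;> cases z i <;> simp [bv]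
    simp only [b]
    rw [Finset.prod_eq_zero (Finset.mem_univ i) this]; simp
  let Φ : (C → ℝ) →ₗ[ℝ] ((R ∩ Y : Finset (ι → Bool)) → ℝ) :=
    { toFun := fun c z => ∑ x : C, c x * a x z
      map_add' := by
        intro c d; funext z; simp [add_mul, Finset.sum_add_distrib]
      map_smul' := by
        intro r c; funext z; simp [Finset.mul_sum, mul_assoc] }
  have hinj : Function.Injective Φ := by
    rw [injective_iff_map_eq_zero]
    intro c hc
    have h0 : ∀ z, z ∈ R → z ∈ Y → ∑ x : C, c x * a x z = 0 := by
      intro z hz1 hz2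
      exact congrFun hc ⟨z, Finset.mem_inter.mpr ⟨hz1, hz2⟩⟩
    have h1 : ∀ z, z ∈ Y → ∑ x : C, c x * a x z = 0 := by
      intro z hz
      by_cases hzR : z ∈ R
      · exact h0 z hzR hz
      · exact Finset.sum_eq_zero fun x _ => by rw [ha x x.2 z hzR, mul_zero]
    have h2 : ∑ z, (∑ x : C, c x * a x z) * (∑ y : C, c y * b y z) = 0 := by
      refine Finset.sum_eq_zero fun z _ => ?_
      by_cases hz : z ∈ Y
      · rw [h1 z hz, zero_mul]
      · rw [Finset.sum_eq_zero (s := Finset.univ) (f := fun y : C => c y * b y z), mul_zero]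
        intro y _
        rw [hb y y.2 z hz, mul_zero]
    have expand : ∀ p q : (ι → Bool) → (ι → Bool) → ℝ,
        ∑ z, (∑ x : C, c x * p x z) * (∑ y : C, c y * q y z)
          = ∑ x : C, ∑ y : C, c x * c y * ∑ z, p x z * q y z := by
      intro p q
      simp_rw [Finset.sum_mul_sum, Finset.mul_sum]
      rw [Finset.sum_comm]
      refine Finset.sum_congr rfl fun x _ => ?_
      rw [Finset.sum_comm]
      refine Finset.sum_congr rfl fun y _ => Finset.sum_congr rfl fun z _ => ?_
      ring
    have h3 : ∑ z, (∑ x : C, c x * g x z) * (∑ y : C, c y * g y z) = 0 := by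
      rw [← h2, expand, expand]
      refine Finset.sum_congr rfl fun x _ => Finset.sum_congr rfl fun y _ => ?_
      congr 1
      exact (inner_eq _ _ _ _).symm
    have h4 : ∀ z, ∑ x : C, c x * g x z = 0 := by
      intro z
      have := (Finset.sum_eq_zero_iff_of_nonneg
        (fun z _ => mul_self_nonneg (∑ x : C, c x * g x z))).mp h3 z (Finset.mem_univ z)
      exact mul_self_eq_zero.mp this
    have h5 := indep_G S (fun x => if hx : x ∈ C then c ⟨x, hx⟩ else 0) (by
      intro z
      refine Eq.trans ?_ (h4 z)
      rw [← Finset.sum_subset (Finset.subset_univ C), ← Finset.sum_coe_sort]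
      · refine Finset.sum_congr rfl fun x _ => ?_
        simp [g]
      · intro x _ hx
        simp [hx])
    funext x
    have := congrFun h5 x
    simpa using this
  have := LinearMap.finrank_le_finrank_of_injective hinj
  rw [Module.finrank_fintype_fun_eq_card, Module.finrank_fintype_fun_eq_card,
    Fintype.card_coe, Fintype.card_coe] at this
  exact this

section weights

variable {Ω : ι → Type*} [∀ i, Fintype (Ω i)]

def mix (x : ι → Bool) (ω ω' : ∀ i, Ω i) : ∀ i, Ω i := fun i => if x i then ω i else ω' i

def box (A B : Set (∀ i, Ω i)) : Set (∀ i, Ω i) :=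
  {ω | ∃ S : Finset ι, (∀ ω' : ∀ i, Ω i, (∀ i ∈ S, ω' i = ω i) → ω' ∈ A) ∧
    (∀ ω' : ∀ i, Ω i, (∀ i, i ∉ S → ω' i = ω i) → ω' ∈ B)}

def swapEquiv (x : ι → Bool) : ((∀ i, Ω i) × (∀ i, Ω i)) ≃ ((∀ i, Ω i) × (∀ i, Ω i)) where
  toFun p := (mix x p.1 p.2, mix x p.2 p.1)
  invFun p := (mix x p.1 p.2, mix x p.2 p.1)
  left_inv p := by ext i <;> simp only [mix] <;> split_ifs <;> rfl
  right_inv p := by ext i <;> simp only [mix] <;> split_ifs <;> rfl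

lemma weight_mix (w : ∀ i, Ω i → ℝ) (x : ι → Bool) (ω ω' : ∀ i, Ω i) :
    (∏ i, w i (mix x ω ω' i)) * (∏ i, w i (mix x ω' ω i))
      = (∏ i, w i (ω i)) * ∏ i, w i (ω' i) := by
  rw [← Finset.prod_mul_distrib, ← Finset.prod_mul_distrib]
  refine Finset.prod_congr rfl fun i _ => ?_
  simp only [mix]
  split_ifs
  · rfl
  · rw [mul_comm]

open Classical in
lemma pair_count (A B : Set (∀ i, Ω i)) (ω ω' : ∀ i, Ω i) :
    ∑ x : ι → Bool, (if mix x ω ω' ∈ box A B then (1 : ℝ) else 0)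
      ≤ ∑ x : ι → Bool, (if mix x ω ω' ∈ A ∧ mix x ω' ω ∈ B then (1 : ℝ) else 0) := by
  rw [Finset.sum_boole, Finset.sum_boole, Nat.cast_le, Finset.filter_and]
  have hS : ∀ x : ι → Bool, ∃ S : Finset ι, mix x ω ω' ∈ box A B →
      (∀ ζ : ∀ i, Ω i, (∀ i ∈ S, ζ i = mix x ω ω' i) → ζ ∈ A) ∧
      (∀ ζ : ∀ i, Ω i, (∀ i, i ∉ S → ζ i = mix x ω ω' i) → ζ ∈ B) := by
    intro x
    by_cases h : mix x ω ω' ∈ box A B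
    · obtain ⟨S, h1⟩ := h
      exact ⟨S, fun _ => h1⟩
    · exact ⟨∅, fun h' => absurd h' h⟩
  choose S hS using hS
  refine butterfly _ (fun x i => decide (i ∉ S x)) _ _ ?_ ?_
  · intro x hx z hz
    rw [Finset.mem_filter] at hx ⊢
    refine ⟨Finset.mem_univ _, (hS x hx.2).1 _ fun i hi => ?_⟩
    have := hz i (by simpa using hi)
    simp [mix, this]
  · intro x hx z hz
    rw [Finset.mem_filter] at hx ⊢
    refine ⟨Finset.mem_univ _, (hS x hx.2).2 _ fun i hi => ?_⟩
    have := hz i (by simpa using hi)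
    simp only [mix, this]
    cases x i <;> simp

open Classical in
lemma bkr_weights (w : ∀ i, Ω i → ℝ) (hw : ∀ i a, 0 ≤ w i a) (hw1 : ∀ i, ∑ a, w i a = 1)
    (A B : Set (∀ i, Ω i)) :
    ∑ ω : ∀ i, Ω i, (if ω ∈ box A B then ∏ i, w i (ω i) else 0) ≤
      (∑ ω : ∀ i, Ω i, if ω ∈ A then ∏ i, w i (ω i) else 0) *
      (∑ ω : ∀ i, Ω i, if ω ∈ B then ∏ i, w i (ω i) else 0) := by
  have htot : ∑ ω : ∀ i, Ω i, ∏ i, w i (ω i) = 1 := by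
    rw [← Fintype.piFinset_univ, ← Finset.prod_univ_sum]
    simp [hw1]
  let W : ((∀ i, Ω i) × (∀ i, Ω i)) → ℝ := fun p => (∏ i, w i (p.1 i)) * ∏ i, w i (p.2 i)
  have hW : ∀ p, 0 ≤ W p := fun p =>
    mul_nonneg (Finset.prod_nonneg fun i _ => hw _ _) (Finset.prod_nonneg fun i _ => hw _ _)
  have swap : ∀ (F : ((∀ i, Ω i) × (∀ i, Ω i)) → ℝ),
      (∑ x : ι → Bool, ∑ p, W p * F (swapEquiv x p)) = (Fintype.card (ι → Bool) : ℝ) * ∑ p, W p * F p := by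
    intro F
    rw [← nsmul_eq_mul, ← Finset.card_univ, ← Finset.sum_const]
    refine Finset.sum_congr rfl fun x _ => ?_
    rw [← Equiv.sum_comp (swapEquiv x) (fun p => W p * F p)]
    refine Finset.sum_congr rfl fun p _ => ?_
    congr 1
    exact (weight_mix w x p.1 p.2).symm
  have lhs : ∑ ω : ∀ i, Ω i, (if ω ∈ box A B then ∏ i, w i (ω i) else 0)
      = ∑ p, W p * (if p.1 ∈ box A B then (1 : ℝ) else 0) := by
    rw [Fintype.sum_prod_type]
    refine Finset.sum_congr rfl fun ω _ => ?_
    simp only [W]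
    by_cases h : ω ∈ box A B
    · simp only [h, if_true, mul_one]
      rw [← Finset.mul_sum, htot, mul_one]
    · simp [h]
  have rhs : (∑ ω : ∀ i, Ω i, if ω ∈ A then ∏ i, w i (ω i) else 0) *
      (∑ ω : ∀ i, Ω i, if ω ∈ B then ∏ i, w i (ω i) else 0)
      = ∑ p, W p * (if p.1 ∈ A ∧ p.2 ∈ B then (1 : ℝ) else 0) := by
    rw [Fintype.sum_prod_type, Finset.sum_mul_sum]
    refine Finset.sum_congr rfl fun ω _ => Finset.sum_congr rfl fun ω' _ => ?_
    simp only [W]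
    by_cases h1 : ω ∈ A <;> by_cases h2 : ω' ∈ B <;> simp [h1, h2]
  rw [lhs, rhs]
  have hpos : (0 : ℝ) < Fintype.card (ι → Bool) := by
    exact_mod_cast Fintype.card_pos
  refine le_of_mul_le_mul_left ?_ hpos
  rw [← swap (fun p => if p.1 ∈ box A B then (1 : ℝ) else 0),
    ← swap (fun p => if p.1 ∈ A ∧ p.2 ∈ B then (1 : ℝ) else 0),
    Finset.sum_comm, Finset.sum_comm (s := (Finset.univ : Finset (ι → Bool)))]
  refine Finset.sum_le_sum fun p _ => ?_
  rw [← Finset.mul_sum, ← Finset.mul_sum]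
  exact mul_le_mul_of_nonneg_left (pair_count A B p.1 p.2) (hW p)

open Classical in
lemma pi_real_eq [∀ i, MeasurableSpace (Ω i)] [∀ i, MeasurableSingletonClass (Ω i)]
    (μi : ∀ i, Measure (Ω i)) [∀ i, IsProbabilityMeasure (μi i)] (A : Set (∀ i, Ω i)) :
    (Measure.pi μi A).toReal
      = ∑ ω : ∀ i, Ω i, if ω ∈ A then ∏ i, (μi i {ω i}).toReal else 0 := by
  have h : Measure.pi μi A = ∑ ω ∈ A.toFinset, Measure.pi μi {ω} := by
    rw [sum_measure_singleton]; simp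
  rw [h, ENNReal.toReal_sum (fun _ _ => measure_ne_top _ _), ← Finset.sum_filter]
  refine Finset.sum_congr (by ext; simp) fun ω _ => ?_
  rw [Measure.pi_singleton, ENNReal.toReal_prod]

lemma bkr [∀ i, MeasurableSpace (Ω i)] [∀ i, MeasurableSingletonClass (Ω i)]
    (μi : ∀ i, Measure (Ω i)) [∀ i, IsProbabilityMeasure (μi i)] (A B : Set (∀ i, Ω i)) :
    (Measure.pi μi (box A B)).toReal ≤ (Measure.pi μi A).toReal * (Measure.pi μi B).toReal := by
  simp only [pi_real_eq]
  refine bkr_weights (fun i a => (μi i {a}).toReal) (fun _ _ => ENNReal.toReal_nonneg) ?_ A B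
  intro i
  rw [← ENNReal.toReal_sum (fun _ _ => measure_ne_top _ _), sum_measure_singleton]
  simp

end weights

lemma bernoulli_pow (L a : ℝ) (hL : 0 ≤ L) (ha : 0 ≤ a) (r : ℕ) :
    L ^ (r + 1) + (r + 1) * a * L ^ r ≤ (L + a) ^ (r + 1) := by
  induction r with
  | zero => simp
  | succ r ih =>
    have h := mul_le_mul_of_nonneg_right ih (add_nonneg hL ha)
    have h2 : 0 ≤ ((r : ℝ) + 1) * a * L ^ r * a := by positivity
    rw [pow_succ (L + a) (r + 1)]
    refine le_trans ?_ h
    push_cast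
    ring_nf at h2 ⊢
    nlinarith [h2]

lemma esymm_bound {α : Type*} [DecidableEq α] (f : α → ℝ) (hf : ∀ i, 0 ≤ f i) (s : Finset α) :
    ∀ r : ℕ, (r.factorial : ℝ) * ∑ I ∈ Finset.powersetCard r s, ∏ i ∈ I, f i ≤ (∑ i ∈ s, f i) ^ r := by
  induction s using Finset.induction_on with
  | empty =>
    intro r
    cases r with
    | zero => simp
    | succ r => rw [Finset.powersetCard_eq_empty.mpr (by simp)]; simp
  | insert a s ha ih =>
    intro r
    cases r with
    | zero => simp
    | succ r =>
      rw [Finset.powersetCard_succ_insert ha, Finset.sum_union, Finset.sum_image, Finset.sum_insert ha]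
      · have h1 : ∑ I ∈ Finset.powersetCard r s, ∏ i ∈ insert a I, f i
            = f a * ∑ I ∈ Finset.powersetCard r s, ∏ i ∈ I, f i := by
          rw [Finset.mul_sum]
          refine Finset.sum_congr rfl fun I hI => Finset.prod_insert fun h => ha ?_
          exact (Finset.mem_powersetCard.mp hI).1 h
        rw [h1]
        have hL : 0 ≤ ∑ i ∈ s, f i := Finset.sum_nonneg fun i _ => hf i
        have h2 := bernoulli_pow _ _ hL (hf a) r
        have h3 := ih (r + 1)
        have h4 := mul_le_mul_of_nonneg_left (ih r) (mul_nonneg (by positivity : (0 : ℝ) ≤ r + 1) (hf a))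
        rw [add_comm (f a)]
        refine le_trans ?_ h2
        rw [mul_add]
        refine add_le_add h3 (le_trans (le_of_eq ?_) h4)
        rw [Nat.factorial_succ]; push_cast; ring
      · intro I hI J hJ h
        have hI' : a ∉ I := fun h => ha ((Finset.mem_powersetCard.mp hI).1 h)
        have hJ' : a ∉ J := fun h => ha ((Finset.mem_powersetCard.mp hJ).1 h)
        rw [← Finset.erase_insert hI', ← Finset.erase_insert hJ']
        exact congrArg (fun K => Finset.erase K a) h
      · rw [Finset.disjoint_left]
        intro I hI hI2
        obtain ⟨J, _, rfl⟩ := Finset.mem_image.mp hI2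
        exact ha ((Finset.mem_powersetCard.mp hI).1 (Finset.mem_insert_self a J))

lemma multi {n k : ℕ} {Ω : Fin n → Type*}
    [∀ i, Fintype (Ω i)]
    [∀ i, MeasurableSpace (Ω i)] [∀ i, MeasurableSingletonClass (Ω i)]
    (μi : ∀ i, Measure (Ω i)) [∀ i, IsProbabilityMeasure (μi i)]
    (A : Fin k → Set (∀ i, Ω i)) (I : Finset (Fin k)) :
    (Measure.pi μi {ω | OccurDisjointly A I ω}).toReal ≤ ∏ i ∈ I, (Measure.pi μi (A i)).toReal := by
  induction I using Finset.induction_on with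
  | empty =>
    rw [Finset.prod_empty]
    exact ENNReal.toReal_le_of_le_ofReal zero_le_one (by simpa using prob_le_one)
  | insert a s ha ih =>
    rw [Finset.prod_insert ha]
    refine le_trans ?_ (mul_le_mul_of_nonneg_left ih ENNReal.toReal_nonneg)
    refine le_trans ?_ (bkr μi _ _)
    refine ENNReal.toReal_mono (measure_ne_top _ _) (measure_mono ?_)
    rintro ω ⟨S, hd, hS⟩
    refine ⟨S a, hS a (Finset.mem_insert_self _ _), fun ω' h' => ⟨S, ?_, ?_⟩⟩
    · intro j hj j' hj'
      exact hd j (Finset.mem_insert_of_mem hj) j' (Finset.mem_insert_of_mem hj')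
    · intro j hj ζ hζ
      refine hS j (Finset.mem_insert_of_mem hj) ζ fun i hi => ?_
      rw [hζ i hi]
      refine h' i fun hia => ?_
      have hne : a ≠ j := fun h => ha (h ▸ hj)
      exact Finset.disjoint_left.mp (hd a (Finset.mem_insert_self _ _) j (Finset.mem_insert_of_mem hj) hne) hia hi

end BKR

/-- **First-moment bound for `r`-fold disjoint occurrences.** In a finite product
probability space with linearly ordered factors, with `λ = Σ μ(A i)`,
`r! · Σ_{|I| = r} μ(□_{i ∈ I} A i) ≤ λ ^ r`. -/
theorem disjoint_occurrence_moment_bound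
    {n k : ℕ} {Ω : Fin n → Type*}
    [∀ i, Fintype (Ω i)] [∀ i, LinearOrder (Ω i)]
    [∀ i, MeasurableSpace (Ω i)] [∀ i, MeasurableSingletonClass (Ω i)]
    (μi : ∀ i, Measure (Ω i)) [∀ i, IsProbabilityMeasure (μi i)]
    (A : Fin k → Set (∀ i, Ω i))
    (lam : ℝ) (hlam : lam = ∑ i, (Measure.pi μi (A i)).toReal) :
    ∀ r : ℕ, r ≤ k →
      (r.factorial : ℝ) *
          ∑ I ∈ Finset.powersetCard r (Finset.univ : Finset (Fin k)),
            (Measure.pi μi {ω | OccurDisjointly A I ω}).toReal ≤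
        lam ^ r := by
  intro r _
  subst hlam
  refine le_trans (mul_le_mul_of_nonneg_left (Finset.sum_le_sum fun I _ => BKR.multi μi A I)
    (by positivity)) ?_
  exact BKR.esymm_bound _ (fun _ => ENNReal.toReal_nonneg) _ r
end
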